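/- arXiv:1401.6569 — 14 statements merged into one kernel-verified Lean document; each statement's English description precedes it below -/
import Mathlib

section
/- Let C > 0 and let α₀ < -√(2C). Define T = (1/√(2C))·log((α₀ - √(2C))/(α₀ + √(2C))) (note T > 0). Then there exists no differentiable function α : [0,T] → ℝ with α(0) = α₀ satisfying the differential inequality α'(t) ≤ -½·α(t)² + C for all t ∈ [0,T]. (In other words, any solution of α' = -½α² + g with ‖g‖_∞ ≤ C starting from α₀ < -√(2C) blows up to -∞ within the time interval [0,T].) -/
/-- A subsolution of `α' = -½α² + C` starting below `-s`, where `s² = 2C`, stays below `-s`. -/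
theorem lt_of_riccati_le {C α₀ T s : ℝ} {α α' : ℝ → ℝ} (hs0 : 0 < s)
    (hsq : s ^ 2 = 2 * C) (hα₀ : α₀ < -s)
    (hd : ∀ t ∈ Set.Icc (0 : ℝ) T, HasDerivWithinAt α (α' t) (Set.Icc (0 : ℝ) T) t)
    (h0 : α 0 = α₀)
    (hle : ∀ t ∈ Set.Icc (0 : ℝ) T, α' t ≤ -(1 / 2) * (α t) ^ 2 + C) :
    ∀ t ∈ Set.Icc (0 : ℝ) T, α t < -s := by
  intro t ht
  refine lt_of_le_of_lt ?_ hα₀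
  refine image_le_of_deriv_right_lt_deriv_boundary' (f' := α') (B := fun _ => α₀)
    (B' := fun _ => 0) (fun x hx => (hd x hx).continuousWithinAt)
    (fun x hx => (hd x ⟨hx.1, hx.2.le⟩).mono_of_mem_nhdsWithin (Icc_mem_nhdsGE_of_mem hx))
    h0.le continuousOn_const (fun x _ => hasDerivWithinAt_const _ _ _) ?_ ht
  intro x hx hxe
  have hx' := hle x ⟨hx.1, hx.2.le⟩
  rw [hxe] at hx'
  nlinarith

/-- Along a subsolution of `α' = -½α² + C` staying below `-s`, where `s² = 2C`, the quantity
`log ((α - s) / (α + s))` decreases at rate at least `s`. -/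
theorem log_sub_log_le_of_riccati_le {C T s : ℝ} {α α' : ℝ → ℝ} (hs0 : 0 < s)
    (hsq : s ^ 2 = 2 * C)
    (hd : ∀ t ∈ Set.Icc (0 : ℝ) T, HasDerivWithinAt α (α' t) (Set.Icc (0 : ℝ) T) t)
    (hlt : ∀ t ∈ Set.Icc (0 : ℝ) T, α t < -s)
    (hle : ∀ t ∈ Set.Icc (0 : ℝ) T, α' t ≤ -(1 / 2) * (α t) ^ 2 + C) :
    ∀ t ∈ Set.Icc (0 : ℝ) T, Real.log (s - α t) - Real.log (-s - α t) ≤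
      Real.log (s - α 0) - Real.log (-s - α 0) - s * t := by
  have hφ : ∀ t ∈ Set.Icc (0 : ℝ) T,
      HasDerivWithinAt (fun t => Real.log (s - α t) - Real.log (-s - α t))
        (-α' t / (s - α t) - -α' t / (-s - α t)) (Set.Icc (0 : ℝ) T) t := by
    intro t ht
    have := hlt t ht
    exact (((hd t ht).const_sub s).log (by linarith)).sub
      (((hd t ht).const_sub (-s)).log (by linarith))
  have hB : ∀ t, HasDerivAt
      (fun t => Real.log (s - α 0) - Real.log (-s - α 0) - s * t) (-s) t := by
    intro t
    simpa using ((hasDerivAt_id t).const_mul s).const_sub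
      (Real.log (s - α 0) - Real.log (-s - α 0))
  intro t ht
  refine image_le_of_deriv_right_le_deriv_boundary (B' := fun _ => -s)
    (fun x hx => (hφ x hx).continuousWithinAt)
    (fun x hx => (hφ x ⟨hx.1, hx.2.le⟩).mono_of_mem_nhdsWithin (Icc_mem_nhdsGE_of_mem hx))
    (by simp) (fun x _ => (hB x).continuousAt.continuousWithinAt)
    (fun x _ => (hB x).hasDerivWithinAt) ?_ ht
  intro x hx
  have hx1 := hlt x ⟨hx.1, hx.2.le⟩
  have hx2 := hle x ⟨hx.1, hx.2.le⟩
  have hp : 0 < s - α x := by linarith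
  have hq : 0 < -s - α x := by linarith
  rw [div_sub_div _ _ hp.ne' hq.ne', div_le_iff₀ (mul_pos hp hq)]
  nlinarith


/-- Theorem 1.1(i) (ODE content): if `α₀ < -√(2C)`, then no differentiable function
`α : [0,T] → ℝ` with `α(0) = α₀` can satisfy `α' ≤ -½α² + C` on all of `[0,T]`,
where `T = (1/√(2C))·log((α₀-√(2C))/(α₀+√(2C)))`; i.e. blow-up to `-∞` occurs by time `T`. -/
theorem blowup_forward_by_time_T
    (C α₀ T : ℝ) (hC : 0 < C)
    (hα₀ : α₀ < -Real.sqrt (2 * C))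
    (hT : T = (1 / Real.sqrt (2 * C)) *
      Real.log ((α₀ - Real.sqrt (2 * C)) / (α₀ + Real.sqrt (2 * C)))) :
    ¬ ∃ α α' : ℝ → ℝ,
        (∀ t ∈ Set.Icc (0 : ℝ) T, HasDerivWithinAt α (α' t) (Set.Icc (0 : ℝ) T) t) ∧
        α 0 = α₀ ∧
        (∀ t ∈ Set.Icc (0 : ℝ) T, α' t ≤ -(1 / 2) * (α t) ^ 2 + C) := by
  rintro ⟨α, α', hd, h0, hle⟩
  obtain ⟨s, hs⟩ : ∃ s, s = Real.sqrt (2 * C) := ⟨_, rfl⟩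
  rw [← hs] at hα₀ hT
  have hs0 : 0 < s := hs ▸ Real.sqrt_pos.2 (by linarith)
  have hsq : s ^ 2 = 2 * C := hs ▸ Real.sq_sqrt (by linarith)
  have hsT : s * T = Real.log (s - α₀) - Real.log (-s - α₀) := by
    have hdiv : (α₀ - s) / (α₀ + s) = (s - α₀) / (-s - α₀) := by
      rw [← neg_div_neg_eq]
      ring
    rw [hT, hdiv, Real.log_div (by linarith) (by linarith)]
    field_simp
  have hT0 : 0 ≤ T := by
    have hlog := Real.log_le_log (x := -s - α₀) (y := s - α₀) (by linarith) (by linarith)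
    by_contra! hneg
    nlinarith
  have hlt := lt_of_riccati_le hs0 hsq hα₀ hd h0 hle
  have hend := log_sub_log_le_of_riccati_le hs0 hsq hd hlt hle T (Set.right_mem_Icc.2 hT0)
  have hltT := hlt T (Set.right_mem_Icc.2 hT0)
  have hlog := Real.log_lt_log (x := -s - α T) (y := s - α T) (by linarith) (by linarith)
  rw [h0] at hend
  linarith
end

section
/- Let C > 0 and let α₀ > √(2C). Define T = (1/√(2C))·log((α₀ - √(2C))/(α₀ + √(2C))) (note T < 0, since (α₀-√(2C))/(α₀+√(2C)) ∈ (0,1)). Then there exists no differentiable function α : [T,0] → ℝ with α(0) = α₀ satisfying the differential inequality α'(t) ≤ -½·α(t)² + C for all t ∈ [T,0]. (In other words, any solution of α' = -½α² + g with ‖g‖_∞ ≤ C reaching the value α₀ > √(2C) at time 0 must have blown up to +∞ within the backward time interval [T,0].) -/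
/-- A function satisfying `f' ≤ -½f² + C` that ends above the equilibrium `√(2C)` stays above its
final value throughout the interval. -/
theorem le_of_riccati_deriv_le {C a b : ℝ} {f f' : ℝ → ℝ}
    (hf : ∀ t ∈ Set.Icc a b, HasDerivWithinAt f (f' t) (Set.Icc a b) t)
    (hf' : ∀ t ∈ Set.Icc a b, f' t ≤ -(1 / 2) * (f t) ^ 2 + C)
    (hb : Real.sqrt (2 * C) < f b) {t : ℝ} (ht : t ∈ Set.Icc a b) : f b ≤ f t := by
  by_contra! hlt
  obtain ⟨c, hc, hcb⟩ := exists_between (max_lt hb hlt)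
  obtain ⟨hsc, htc⟩ := max_lt_iff.1 hc
  have hsub : Set.Icc t b ⊆ Set.Icc a b := Set.Icc_subset_Icc_left ht.1
  have hle : f b ≤ c := by
    refine image_le_of_deriv_right_lt_deriv_boundary (f' := f') (B := fun _ => c)
      (B' := fun _ => 0) (fun x hx => ((hf x (hsub hx)).mono hsub).continuousWithinAt) ?_ htc.le
      (fun x => hasDerivAt_const x c) ?_ (Set.right_mem_Icc.2 ht.2)
    · intro x hx
      exact (hf x (hsub (Set.Ico_subset_Icc_self hx))).mono_of_mem_nhdsWithin
        (Filter.mem_of_superset (Icc_mem_nhdsGE hx.2)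
          (Set.Icc_subset_Icc_left (ht.1.trans hx.1)))
    · intro x hx hxc
      have h := hf' x (hsub (Set.Ico_subset_Icc_self hx))
      have h2 : 2 * C < c ^ 2 := Real.lt_sq_of_sqrt_lt hsc
      rw [hxc] at h
      linarith
  exact hle.not_gt hcb


/-- Theorem 1.1(ii) (ODE content): if `α₀ > √(2C)`, then no differentiable function
`α : [T,0] → ℝ` with `α(0) = α₀` can satisfy `α' ≤ -½α² + C` on all of `[T,0]`,
where `T = (1/√(2C))·log((α₀-√(2C))/(α₀+√(2C))) < 0`; i.e. blow-up to `+∞`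
occurred within the backward time interval `[T,0]`. -/
theorem blowup_backward_by_time_T
    (C α₀ T : ℝ) (hC : 0 < C)
    (hα₀ : Real.sqrt (2 * C) < α₀)
    (hT : T = (1 / Real.sqrt (2 * C)) *
      Real.log ((α₀ - Real.sqrt (2 * C)) / (α₀ + Real.sqrt (2 * C)))) :
    ¬ ∃ α α' : ℝ → ℝ,
        (∀ t ∈ Set.Icc T (0 : ℝ), HasDerivWithinAt α (α' t) (Set.Icc T (0 : ℝ)) t) ∧
        α 0 = α₀ ∧
        (∀ t ∈ Set.Icc T (0 : ℝ), α' t ≤ -(1 / 2) * (α t) ^ 2 + C) := by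
  rintro ⟨α, α', hα, h0, hle⟩
  set s := Real.sqrt (2 * C)
  have hs0 : 0 < s := Real.sqrt_pos.2 (by linarith)
  have hs2 : s ^ 2 = 2 * C := Real.sq_sqrt (by linarith)
  have hw0 : 0 < (α₀ - s) / (α₀ + s) := div_pos (by linarith) (by linarith)
  have hw1 : (α₀ - s) / (α₀ + s) < 1 := (div_lt_one (by linarith)).2 (by linarith)
  have hsT : s * T = Real.log ((α₀ - s) / (α₀ + s)) := by
    rw [hT]
    field_simp
  have hT0 : T ≤ 0 := by
    have hlog := Real.log_neg hw0 hw1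
    nlinarith
  have hge : ∀ t ∈ Set.Icc T 0, α₀ ≤ α t := fun t ht => by
    simpa only [h0] using le_of_riccati_deriv_le hα hle (by rwa [h0]) ht
  have hderiv : ∀ t ∈ Set.Icc T 0,
      HasDerivWithinAt (fun t => (α t - s) / (α t + s) * Real.exp (s * t))
        ((α' t * (α t + s) - (α t - s) * α' t) / (α t + s) ^ 2 * Real.exp (s * t) +
          (α t - s) / (α t + s) * (Real.exp (s * t) * (s * 1))) (Set.Icc T 0) t := by
    intro t ht
    have hpos : α t + s ≠ 0 := by linarith [hge t ht]
    exact (((hα t ht).sub_const s).div ((hα t ht).add_const s) hpos).mul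
      ((hasDerivWithinAt_id t _).const_mul s).exp
  have hanti : AntitoneOn (fun t => (α t - s) / (α t + s) * Real.exp (s * t)) (Set.Icc T 0) := by
    refine antitoneOn_of_hasDerivWithinAt_nonpos (convex_Icc T 0)
      (fun t ht => (hderiv t ht).continuousWithinAt)
      (fun t ht => (hderiv t (interior_subset ht)).mono interior_subset) fun t ht => ?_
    have hpos : 0 < α t + s := by linarith [hge t (interior_subset ht)]
    have hfactor : (α' t * (α t + s) - (α t - s) * α' t) / (α t + s) ^ 2 * Real.exp (s * t) +
          (α t - s) / (α t + s) * (Real.exp (s * t) * (s * 1)) =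
        2 * s * Real.exp (s * t) / (α t + s) ^ 2 * (α' t + 1 / 2 * (α t ^ 2 - s ^ 2)) := by
      field_simp
      ring
    rw [hfactor]
    refine mul_nonpos_of_nonneg_of_nonpos (by positivity) ?_
    linarith [hle t (interior_subset ht)]
  have hcmp := hanti (Set.left_mem_Icc.2 hT0) (Set.right_mem_Icc.2 hT0) hT0
  simp only [h0, mul_zero, Real.exp_zero, mul_one, hsT, Real.exp_log hw0] at hcmp
  have hone : 1 ≤ (α T - s) / (α T + s) := le_of_mul_le_mul_right (by rwa [one_mul]) hw0
  have hposT : 0 < α T + s := by linarith [hge T (Set.left_mem_Icc.2 hT0)]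
  rw [one_le_div hposT] at hone
  linarith
end

section
/- Let 0 < t_b < ∞, let C ≥ 0, and let g : [0, t_b) → ℝ satisfy |g(t)| ≤ C for all t. Suppose α, β : [0, t_b) → ℝ are differentiable and satisfy the system α'(t) = ½·β(t)² - ½·α(t)² + g(t) and β'(t) = -α(t)·β(t) for all t ∈ [0, t_b), with β(0) ≠ 0. Then α(t) does not tend to -∞ as t → t_b from the left (i.e., it is not the case that for every M there exists t₀ < t_b such that α(t) ≤ M for all t ∈ (t₀, t_b)). -/
/-- The quantity `β² / (1 + α² + β²)²` decays at most exponentially along the flow of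
`α' = ½β² - ½α² + g`, `β' = -αβ` with `|g| ≤ C`. -/
theorem monotoneOn_exp_mul_sq_div {T C : ℝ} {g α β : ℝ → ℝ}
    (hg : ∀ t ∈ Set.Ico (0 : ℝ) T, |g t| ≤ C)
    (hα : ∀ t ∈ Set.Ico (0 : ℝ) T, HasDerivWithinAt α
      ((1 / 2) * (β t) ^ 2 - (1 / 2) * (α t) ^ 2 + g t) (Set.Ico (0 : ℝ) T) t)
    (hβ : ∀ t ∈ Set.Ico (0 : ℝ) T,
      HasDerivWithinAt β (-(α t * β t)) (Set.Ico (0 : ℝ) T) t) :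
    MonotoneOn (fun t => Real.exp ((1 + 2 * C) * t) * (β t / (1 + α t ^ 2 + β t ^ 2)) ^ 2)
      (Set.Ico (0 : ℝ) T) := by
  have hS : ∀ t, 0 < 1 + α t ^ 2 + β t ^ 2 := fun t => by positivity
  have hderiv : ∀ t ∈ Set.Ico (0 : ℝ) T, HasDerivWithinAt
      (fun t => Real.exp ((1 + 2 * C) * t) * (β t / (1 + α t ^ 2 + β t ^ 2)) ^ 2)
      (Real.exp ((1 + 2 * C) * t) * (β t / (1 + α t ^ 2 + β t ^ 2)) ^ 2 *
        (((1 + 2 * C) * (1 + α t ^ 2 + β t ^ 2) - 2 * α t * (1 + 2 * g t)) /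
          (1 + α t ^ 2 + β t ^ 2))) (Set.Ico (0 : ℝ) T) t := by
    intro t ht
    have hexp := (((hasDerivAt_id t).const_mul (1 + 2 * C)).exp).hasDerivWithinAt
      (s := Set.Ico (0 : ℝ) T)
    have hden := (((hα t ht).pow 2).const_add 1).add ((hβ t ht).pow 2)
    have hquot := ((hβ t ht).div hden (hS t).ne').pow 2
    refine (hexp.mul hquot).congr_deriv ?_
    have hne := (hS t).ne'
    simp only [Pi.add_apply, Pi.pow_apply, Pi.div_apply, id, Nat.cast_ofNat, Nat.add_one_sub_one,
      pow_one]
    field_simp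
    ring
  refine monotoneOn_of_hasDerivWithinAt_nonneg (convex_Ico 0 T)
    (fun t ht => (hderiv t ht).continuousWithinAt)
    (fun t ht => (hderiv t (interior_subset ht)).mono interior_subset) fun t ht => ?_
  have hgt := hg t (interior_subset ht)
  have hC : 0 ≤ C := (abs_nonneg _).trans hgt
  have hfac : |2 * α t * (1 + 2 * g t)| ≤ (1 + α t ^ 2 + β t ^ 2) * (1 + 2 * C) := by
    rw [abs_mul]
    refine mul_le_mul ?_ ?_ (abs_nonneg _) (hS t).le
    · exact abs_le.2 ⟨by nlinarith [sq_nonneg (α t + 1), sq_nonneg (β t)],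
        by nlinarith [sq_nonneg (α t - 1), sq_nonneg (β t)]⟩
    · obtain ⟨h₁, h₂⟩ := abs_le.1 hgt
      exact abs_le.2 ⟨by linarith, by linarith⟩
  have hnum : 0 ≤ (1 + 2 * C) * (1 + α t ^ 2 + β t ^ 2) - 2 * α t * (1 + 2 * g t) := by
    linarith [le_abs_self (2 * α t * (1 + 2 * g t))]
  exact mul_nonneg (by positivity) (div_nonneg hnum (hS t).le)

/-- Theorem 1.1(iii) (ODE content): for the system `α' = ½β² - ½α² + g`, `β' = -αβ`
on `[0, t_b)` with `|g| ≤ C` and `β(0) ≠ 0`, the function `α` cannot tend to `-∞`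
as `t → t_b⁻`. -/
theorem no_blowup_to_neg_infty_of_beta_ne_zero
    (t_b C : ℝ) (htb : 0 < t_b) (hC : 0 ≤ C)
    (g α β α' β' : ℝ → ℝ)
    (hg : ∀ t ∈ Set.Ico (0 : ℝ) t_b, |g t| ≤ C)
    (hα : ∀ t ∈ Set.Ico (0 : ℝ) t_b, HasDerivWithinAt α (α' t) (Set.Ico (0 : ℝ) t_b) t)
    (hβ : ∀ t ∈ Set.Ico (0 : ℝ) t_b, HasDerivWithinAt β (β' t) (Set.Ico (0 : ℝ) t_b) t)
    (hαeq : ∀ t ∈ Set.Ico (0 : ℝ) t_b,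
      α' t = (1 / 2) * (β t) ^ 2 - (1 / 2) * (α t) ^ 2 + g t)
    (hβeq : ∀ t ∈ Set.Ico (0 : ℝ) t_b, β' t = -(α t * β t))
    (hβ0 : β 0 ≠ 0) :
    ¬ ∀ M : ℝ, ∃ t₀ < t_b, ∀ t, t₀ < t → t < t_b → α t ≤ M := by
  intro h
  have hmono := monotoneOn_exp_mul_sq_div hg (fun t ht => hαeq t ht ▸ hα t ht)
    (fun t ht => hβeq t ht ▸ hβ t ht)
  set c := (β 0 / (1 + α 0 ^ 2 + β 0 ^ 2)) ^ 2 with hc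
  set E := Real.exp ((1 + 2 * C) * t_b) with hE
  have hcpos : 0 < c := by positivity
  have hEpos : 0 < E := Real.exp_pos _
  have hbound : ∀ t ∈ Set.Ico (0 : ℝ) t_b, α t ^ 2 ≤ E / c := by
    intro t ht
    have h₁ := hmono ⟨le_rfl, htb⟩ ht ht.1
    simp only [mul_zero, Real.exp_zero, one_mul] at h₁
    rw [← hc] at h₁
    have hexp : Real.exp ((1 + 2 * C) * t) ≤ E :=
      Real.exp_le_exp.2 (mul_le_mul_of_nonneg_left ht.2.le (by positivity))
    have hS : 0 < 1 + α t ^ 2 + β t ^ 2 := by positivity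
    have hq : (β t / (1 + α t ^ 2 + β t ^ 2)) ^ 2 ≤ 1 / (1 + α t ^ 2 + β t ^ 2) := by
      rw [div_pow, div_le_div_iff₀ (by positivity) hS]
      nlinarith [sq_nonneg (α t)]
    have h₂ : c ≤ E * (1 / (1 + α t ^ 2 + β t ^ 2)) :=
      h₁.trans (mul_le_mul hexp hq (by positivity) hEpos.le)
    rw [mul_one_div, le_div_iff₀ hS] at h₂
    rw [le_div_iff₀ hcpos]
    nlinarith [sq_nonneg (β t)]
  obtain ⟨t₀, ht₀, hM⟩ := h (-(E / c + 1))
  obtain ⟨t, hlt, htlt⟩ := exists_between (max_lt ht₀ htb)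
  have hαt := hM t ((le_max_left _ _).trans_lt hlt) htlt
  have hαb := hbound t ⟨((le_max_right _ _).trans_lt hlt).le, htlt⟩
  have hKpos : 0 < E / c := by positivity
  nlinarith
end

section
/- Let 0 < t_b < ∞, let C ≥ 0, and let g : [0, t_b) → ℝ satisfy |g(t)| ≤ C for all t. Suppose α, β : [0, t_b) → ℝ are differentiable and satisfy α'(t) = ½·β(t)² - ½·α(t)² + g(t) and β'(t) = -α(t)·β(t) for all t ∈ [0, t_b), with β(0) ≠ 0. Then α(t) does not tend to +∞ as t → t_b from the left. -/
/-- Concluding remark of the paper: for the system `α' = ½β² - ½α² + g`, `β' = -αβ`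
on `[0, t_b)` with `|g| ≤ C` and `β(0) ≠ 0`, the function `α` cannot tend to `+∞`
as `t → t_b⁻`. -/
theorem no_blowup_to_pos_infty_of_beta_ne_zero
    (t_b C : ℝ) (htb : 0 < t_b) (hC : 0 ≤ C)
    (g α β α' β' : ℝ → ℝ)
    (hg : ∀ t ∈ Set.Ico (0 : ℝ) t_b, |g t| ≤ C)
    (hα : ∀ t ∈ Set.Ico (0 : ℝ) t_b, HasDerivWithinAt α (α' t) (Set.Ico (0 : ℝ) t_b) t)
    (hβ : ∀ t ∈ Set.Ico (0 : ℝ) t_b, HasDerivWithinAt β (β' t) (Set.Ico (0 : ℝ) t_b) t)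
    (hαeq : ∀ t ∈ Set.Ico (0 : ℝ) t_b,
      α' t = (1 / 2) * (β t) ^ 2 - (1 / 2) * (α t) ^ 2 + g t)
    (hβeq : ∀ t ∈ Set.Ico (0 : ℝ) t_b, β' t = -(α t * β t))
    (hβ0 : β 0 ≠ 0) :
    ¬ ∀ M : ℝ, ∃ t₀ < t_b, ∀ t, t₀ < t → t < t_b → M ≤ α t := by
  intro hlim
  obtain ⟨t₀, ht₀, hα₀⟩ := hlim 0
  obtain ⟨t₁, ht₁, ht₁b⟩ := exists_between (max_lt ht₀ htb)
  obtain ⟨ht₀₁, h0t₁⟩ := max_lt_iff.1 ht₁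
  have hsub : Set.Ico t₁ t_b ⊆ Set.Ico 0 t_b := Set.Ico_subset_Ico_left h0t₁.le
  have hint : interior (Set.Ico t₁ t_b) ⊆ Set.Ico t₁ t_b := interior_subset
  have hα_nonneg : ∀ t ∈ Set.Ico t₁ t_b, 0 ≤ α t := fun t ht ↦
    hα₀ t (ht₀₁.trans_le ht.1) ht.2
  have hβ_sq : AntitoneOn (fun t ↦ β t ^ 2) (Set.Ico t₁ t_b) := by
    have hd : ∀ t ∈ Set.Ico t₁ t_b,
        HasDerivWithinAt (fun t ↦ β t ^ 2) (2 * β t * β' t) (Set.Ico t₁ t_b) t := by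
      intro t ht
      simpa using ((hβ t (hsub ht)).mono hsub).fun_pow 2
    refine antitoneOn_of_hasDerivWithinAt_nonpos (convex_Ico _ _)
      (fun t ht ↦ (hd t ht).continuousWithinAt) (fun t ht ↦ (hd t (hint ht)).mono hint) ?_
    intro t ht
    rw [hβeq t (hsub (hint ht))]
    nlinarith [mul_nonneg (hα_nonneg t (hint ht)) (sq_nonneg (β t))]
  set K : ℝ := 1 / 2 * β t₁ ^ 2 + C with hK
  have hK_nonneg : 0 ≤ K := by positivity
  have hα_sub : AntitoneOn (fun t ↦ α t - K * t) (Set.Ico t₁ t_b) := by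
    have hd : ∀ t ∈ Set.Ico t₁ t_b,
        HasDerivWithinAt (fun t ↦ α t - K * t) (α' t - K) (Set.Ico t₁ t_b) t := by
      intro t ht
      simpa using ((hα t (hsub ht)).mono hsub).fun_sub ((hasDerivWithinAt_id t _).const_mul K)
    refine antitoneOn_of_hasDerivWithinAt_nonpos (convex_Ico _ _)
      (fun t ht ↦ (hd t ht).continuousWithinAt) (fun t ht ↦ (hd t (hint ht)).mono hint) ?_
    intro t ht
    have ht' := hint ht
    have hβt : β t ^ 2 ≤ β t₁ ^ 2 := hβ_sq (Set.left_mem_Ico.2 ht₁b) ht' ht'.1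
    rw [hαeq t (hsub ht')]
    linarith [le_of_abs_le (hg t (hsub ht')), sq_nonneg (α t)]
  obtain ⟨t₂, ht₂, hα₂⟩ := hlim (α t₁ + K * t_b + 1)
  obtain ⟨t, ht, htb'⟩ := exists_between (max_lt ht₂ ht₁b)
  obtain ⟨ht₂t, ht₁t⟩ := max_lt_iff.1 ht
  have hle : α t - K * t ≤ α t₁ - K * t₁ :=
    hα_sub (Set.left_mem_Ico.2 ht₁b) ⟨ht₁t.le, htb'⟩ ht₁t.le
  linarith [hα₂ t ht₂t htb', mul_nonneg hK_nonneg h0t₁.le,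
    mul_le_mul_of_nonneg_left htb'.le hK_nonneg]
end

section
/- Let C > 0, set s = √(2C), let γ₀ < -s, and let T = (1/s)·log((γ₀ - s)/(γ₀ + s)) be the blow-up time of the explicit solution γ(t) = (s·γ₀ + 2C + (s·γ₀ - 2C)·e^{-st})/(γ₀ + s - (γ₀ - s)·e^{-st}). Let b > 0 and let α : [0, b) → ℝ be differentiable with α'(t) ≤ -½·α(t)² + C for all t and α(0) ≤ γ₀. Then α(t) ≤ γ(t) for all t ∈ [0, min(b, T)). -/
/-- A subsolution of the Riccati equation `y' = -½y² + C` stays below a solution which it does not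
exceed initially. -/
theorem riccati_subsolution_le_solution {C a b : ℝ} {α α' γ : ℝ → ℝ}
    (hα : ContinuousOn α (Set.Icc a b))
    (hα' : ∀ t ∈ Set.Ico a b, HasDerivWithinAt α (α' t) (Set.Ici t) t)
    (hineq : ∀ t ∈ Set.Ico a b, α' t ≤ -(1 / 2) * (α t) ^ 2 + C)
    (hγ : ContinuousOn γ (Set.Icc a b))
    (hγ' : ∀ t ∈ Set.Ico a b, HasDerivWithinAt γ (-(1 / 2) * (γ t) ^ 2 + C) (Set.Ici t) t)
    (ha : α a ≤ γ a) {t : ℝ} (ht : t ∈ Set.Icc a b) : α t ≤ γ t := by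
  obtain ⟨K, hK⟩ := isCompact_Icc.exists_bound_of_continuousOn hγ
  have key : ∀ ε > 0, α t - γ t ≤ ε * Real.exp (K * t) := by
    intro ε hε
    have hB : ∀ x, HasDerivAt (fun x => ε * Real.exp (K * x)) (K * (ε * Real.exp (K * x))) x := by
      intro x
      refine ((((hasDerivAt_id x).const_mul K).exp).const_mul ε).congr_deriv ?_
      simp only [id]
      ring
    refine image_le_of_deriv_right_lt_deriv_boundary' (f := fun x => α x - γ x)
      (f' := fun x => α' x - (-(1 / 2) * (γ x) ^ 2 + C)) (hα.sub hγ)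
      (fun x hx => (hα' x hx).sub (hγ' x hx)) ?_
      (fun x _ => (hB x).continuousAt.continuousWithinAt)
      (fun x _ => (hB x).hasDerivWithinAt) ?_ ht
    · exact (sub_nonpos.2 ha).trans (by positivity)
    · intro x hx hxB
      have hpos : 0 < ε * Real.exp (K * x) := by positivity
      have hγK : -K ≤ γ x := neg_le_of_abs_le (hK x (Set.Ico_subset_Icc_self hx))
      have hαx := hineq x hx
      rw [show α x = γ x + ε * Real.exp (K * x) by linarith] at hαx
      nlinarith
  have hlim : Filter.Tendsto (fun ε : ℝ => ε * Real.exp (K * t)) (nhdsWithin 0 (Set.Ioi 0))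
      (nhds 0) := by
    have h : Continuous fun ε : ℝ => ε * Real.exp (K * t) := by fun_prop
    simpa using (h.tendsto 0).mono_left nhdsWithin_le_nhds
  exact sub_nonpos.1 (ge_of_tendsto hlim (Filter.eventually_of_mem self_mem_nhdsWithin key))

/-- The explicit solution of `y' = -½y² + s²/2` with initial value `y₀`. -/
theorem hasDerivAt_riccati_solution {C s y₀ t : ℝ} (hs : s ^ 2 = 2 * C)
    (hD : y₀ + s - (y₀ - s) * Real.exp (-s * t) ≠ 0) :
    HasDerivAt (fun t => (s * y₀ + 2 * C + (s * y₀ - 2 * C) * Real.exp (-s * t)) /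
        (y₀ + s - (y₀ - s) * Real.exp (-s * t)))
      (-(1 / 2) * ((s * y₀ + 2 * C + (s * y₀ - 2 * C) * Real.exp (-s * t)) /
        (y₀ + s - (y₀ - s) * Real.exp (-s * t))) ^ 2 + C) t := by
  have hE : HasDerivAt (fun t => Real.exp (-s * t)) (Real.exp (-s * t) * (-s)) t := by
    simpa using ((hasDerivAt_id t).const_mul (-s)).exp
  refine (((hE.const_mul (s * y₀ - 2 * C)).const_add (s * y₀ + 2 * C)).div
    ((hE.const_mul (y₀ - s)).const_sub (y₀ + s)) hD).congr_deriv ?_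
  obtain rfl : C = s ^ 2 / 2 := by linarith
  generalize Real.exp (-s * t) = E at *
  field_simp
  ring

/-- The denominator of the explicit Riccati solution is positive before the blow-up time. -/
theorem riccati_denominator_pos {s y₀ t : ℝ} (hs : 0 < s) (hy₀ : y₀ < -s)
    (ht : t < (1 / s) * Real.log ((y₀ - s) / (y₀ + s))) :
    0 < y₀ + s - (y₀ - s) * Real.exp (-s * t) := by
  have hA : y₀ + s < 0 := by linarith
  have hB : y₀ - s < 0 := by linarith
  rw [one_div_mul_eq_div, lt_div_iff₀ hs, Real.lt_log_iff_exp_lt (div_pos_of_neg_of_neg hB hA),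
    lt_div_iff_of_neg hA] at ht
  have h := mul_lt_mul_of_pos_right ht (Real.exp_pos (-s * t))
  have hone : Real.exp (t * s) * Real.exp (-s * t) = 1 := by
    rw [← Real.exp_add, show t * s + -s * t = 0 by ring, Real.exp_zero]
  linear_combination h + (y₀ + s) * hone

/-- Comparison argument: any differentiable `α : [0,b) → ℝ` with `α' ≤ -½α² + C` and
`α(0) ≤ γ₀ < -√(2C)` is dominated by the explicit Riccati solution `γ` with
`γ(0) = γ₀`, up to the blow-up time `T` of `γ`. -/
theorem riccati_comparison
    (C γ₀ s T b : ℝ) (hC : 0 < C) (hs : s = Real.sqrt (2 * C)) (hγ₀ : γ₀ < -s)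
    (hT : T = (1 / s) * Real.log ((γ₀ - s) / (γ₀ + s)))
    (γ : ℝ → ℝ)
    (hγ : ∀ t, γ t = (s * γ₀ + 2 * C + (s * γ₀ - 2 * C) * Real.exp (-s * t)) /
      (γ₀ + s - (γ₀ - s) * Real.exp (-s * t)))
    (hb : 0 < b) (α α' : ℝ → ℝ)
    (hderiv : ∀ t ∈ Set.Ico (0 : ℝ) b, HasDerivWithinAt α (α' t) (Set.Ico (0 : ℝ) b) t)
    (hineq : ∀ t ∈ Set.Ico (0 : ℝ) b, α' t ≤ -(1 / 2) * (α t) ^ 2 + C)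
    (h0 : α 0 ≤ γ₀) :
    ∀ t ∈ Set.Ico (0 : ℝ) (min b T), α t ≤ γ t := by
  have hs0 : 0 < s := hs ▸ Real.sqrt_pos.2 (by positivity)
  have hs2 : s ^ 2 = 2 * C := hs ▸ Real.sq_sqrt (by positivity)
  rintro t ⟨ht0, ht⟩
  obtain ⟨htb, htT⟩ := lt_min_iff.1 ht
  have hγ' : ∀ x ≤ t, HasDerivAt γ (-(1 / 2) * (γ x) ^ 2 + C) x := by
    intro x hx
    rw [funext hγ]
    exact hasDerivAt_riccati_solution hs2
      (riccati_denominator_pos hs0 hγ₀ (hT ▸ hx.trans_lt htT)).ne'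
  have hγ0 : γ 0 = γ₀ := by
    rw [hγ, mul_zero, Real.exp_zero]
    rw [div_eq_iff (by linarith)]
    ring
  refine riccati_subsolution_le_solution (α' := α')
    (fun x hx => (hderiv x ⟨hx.1, hx.2.trans_lt htb⟩).continuousWithinAt.mono
      fun y hy => ⟨hy.1, hy.2.trans_lt htb⟩)
    (fun x hx => ?_) (fun x hx => hineq x ⟨hx.1, hx.2.trans htb⟩)
    (fun x hx => (hγ' x hx.2).continuousAt.continuousWithinAt)
    (fun x hx => (hγ' x hx.2.le).hasDerivWithinAt) (h0.trans_eq hγ0.symm) ⟨ht0, le_rfl⟩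
  have hxb : x < b := hx.2.trans htb
  exact (hderiv x ⟨hx.1, hxb⟩).mono_of_mem_nhdsWithin
    (Filter.mem_of_superset (Ico_mem_nhdsGE hxb) (Set.Ico_subset_Ico_left hx.1))
end

section
/- Let I ⊆ ℝ be an interval and let a, b, c, r, e : I → ℝ be functions such that a and b are differentiable on I, r is constant on I, a(t) > 0 for all t ∈ I, and for all t ∈ I: a'(t) = b(t), b'(t) = ½·c(t) + e(t)·a(t), and a(t)·c(t) = b(t)² + r(t)². Then the functions α := b/a and β := r/a are differentiable on I and satisfy α'(t) = ½·β(t)² - ½·α(t)² + e(t) and β'(t) = -α(t)·β(t) for all t ∈ I. -/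
/-- Derivation of the closed system for `α = b/a` and `β = r/a` from the Lagrangian
equations `a' = b`, `b' = ½c + e·a`, `r' = 0` (r constant), with constraint
`a·c = b² + r²` and `a > 0`:  one gets `α' = ½β² - ½α² + e` and `β' = -αβ`. -/
theorem lagrangian_to_alpha_beta_system
    (I : Set ℝ) (hI : I.OrdConnected)
    (a b c r e : ℝ → ℝ)
    (ha : ∀ t ∈ I, HasDerivWithinAt a (b t) I t)
    (hb : ∀ t ∈ I, HasDerivWithinAt b ((1 / 2) * c t + e t * a t) I t)
    (hrconst : ∀ s ∈ I, ∀ t ∈ I, r s = r t)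
    (hapos : ∀ t ∈ I, 0 < a t)
    (hconstraint : ∀ t ∈ I, a t * c t = (b t) ^ 2 + (r t) ^ 2) :
    ∀ t ∈ I,
      HasDerivWithinAt (fun u => b u / a u)
        ((1 / 2) * (r t / a t) ^ 2 - (1 / 2) * (b t / a t) ^ 2 + e t) I t ∧
      HasDerivWithinAt (fun u => r u / a u)
        (-((b t / a t) * (r t / a t))) I t := by
  intro t ht
  have hne : a t ≠ 0 := (hapos t ht).ne'
  have hr : HasDerivWithinAt r 0 I t :=
    (hasDerivWithinAt_const t I (r t)).congr (fun s hs => hrconst s hs t ht) rfl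
  refine ⟨((hb t ht).fun_div (ha t ht) hne).congr_deriv ?_,
    (hr.fun_div (ha t ht) hne).congr_deriv ?_⟩
  · field_simp
    linear_combination hconstraint t ht
  · field_simp
    ring
end

section
/- Let C ≥ 0, let t₁ < t₂, let g : [t₁, t₂] → ℝ with |g(t)| ≤ C for all t, and let α, β : [t₁, t₂] → ℝ be differentiable with β(t) ≠ 0 for all t, satisfying α'(t) = ½·β(t)² - ½·α(t)² + g(t) and β'(t) = -α(t)·β(t) on [t₁, t₂]. If moreover α(t) ≤ 0 and α(t)² ≥ 2C for all t ∈ [t₁, t₂], then the function t ↦ α(t)²/β(t)² is nonincreasing on [t₁, t₂]. -/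
/-- Monotonicity step in the proof of Theorem 1.1(iii): for the system
`α' = ½β² - ½α² + g`, `β' = -αβ` on `[t₁, t₂]` with `|g| ≤ C`, `β ≠ 0`, if `α ≤ 0`
and `α² ≥ 2C` throughout, then `α²/β²` is nonincreasing on `[t₁, t₂]`. -/
theorem quotient_nonincreasing
    (C t₁ t₂ : ℝ) (hC : 0 ≤ C) (ht : t₁ < t₂)
    (g α β : ℝ → ℝ)
    (hg : ∀ t ∈ Set.Icc t₁ t₂, |g t| ≤ C)
    (hβne : ∀ t ∈ Set.Icc t₁ t₂, β t ≠ 0)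
    (hα : ∀ t ∈ Set.Icc t₁ t₂, HasDerivWithinAt α
      ((1 / 2) * (β t) ^ 2 - (1 / 2) * (α t) ^ 2 + g t) (Set.Icc t₁ t₂) t)
    (hβ : ∀ t ∈ Set.Icc t₁ t₂, HasDerivWithinAt β (-(α t * β t)) (Set.Icc t₁ t₂) t)
    (hαneg : ∀ t ∈ Set.Icc t₁ t₂, α t ≤ 0)
    (hαsq : ∀ t ∈ Set.Icc t₁ t₂, 2 * C ≤ (α t) ^ 2) :
    AntitoneOn (fun t => (α t) ^ 2 / (β t) ^ 2) (Set.Icc t₁ t₂) := by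
  have hderiv : ∀ t ∈ Set.Icc t₁ t₂, HasDerivWithinAt (fun t => (α t) ^ 2 / (β t) ^ 2)
      (α t / (β t) ^ 2 * ((α t) ^ 2 + (β t) ^ 2 + 2 * g t)) (Set.Icc t₁ t₂) t := by
    intro t h
    have hb := hβne t h
    refine (((hα t h).fun_pow 2).fun_div ((hβ t h).fun_pow 2) (pow_ne_zero 2 hb)).congr_deriv ?_
    field_simp
    ring
  refine antitoneOn_of_hasDerivWithinAt_nonpos (convex_Icc t₁ t₂)
    (fun t h => (hderiv t h).continuousWithinAt)
    (fun t h => (hderiv t (interior_subset h)).mono interior_subset) fun t h => ?_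
  have h' := interior_subset h
  refine mul_nonpos_of_nonpos_of_nonneg
    (div_nonpos_of_nonpos_of_nonneg (hαneg t h') (sq_nonneg _)) ?_
  linarith [neg_le_of_abs_le (hg t h'), hαsq t h', sq_nonneg (β t)]
end

section
/- Let C ≥ 0, let t̃ < t_b ≤ ∞, let g : [t̃, t_b) → ℝ with |g(t)| ≤ C for all t, and let α, β : [t̃, t_b) → ℝ be differentiable with β(t) ≠ 0 for all t, satisfying α'(t) = ½·β(t)² - ½·α(t)² + g(t) and β'(t) = -α(t)·β(t) on [t̃, t_b). If moreover α(t) ≤ 0 and α(t)² ≥ 2C for all t ∈ [t̃, t_b), then for every t ∈ [t̃, t_b): ∫_{t̃}^{t} (-α(s)) ds ≤ α(t̃)²/β(t̃)². -/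
/-- Integral bound in the proof of Theorem 1.1(iii): for the system
`α' = ½β² - ½α² + g`, `β' = -αβ` on `[t̃, t_b)` (with `t_b ∈ (t̃, ∞]`, `|g| ≤ C`,
`β ≠ 0`), if `α ≤ 0` and `α² ≥ 2C` throughout, then
`∫_{t̃}^{t} (-α) ≤ α(t̃)²/β(t̃)²` for every `t ∈ [t̃, t_b)`. -/
theorem integral_bound_neg_alpha
    (C t_tilde : ℝ) (hC : 0 ≤ C) (t_b : EReal) (ht : (t_tilde : EReal) < t_b)
    (g α β α' β' : ℝ → ℝ)
    (hg : ∀ t : ℝ, t ∈ {u : ℝ | t_tilde ≤ u ∧ (u : EReal) < t_b} → |g t| ≤ C)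
    (hβne : ∀ t : ℝ, t ∈ {u : ℝ | t_tilde ≤ u ∧ (u : EReal) < t_b} → β t ≠ 0)
    (hα : ∀ t : ℝ, t ∈ {u : ℝ | t_tilde ≤ u ∧ (u : EReal) < t_b} →
      HasDerivWithinAt α (α' t) {u : ℝ | t_tilde ≤ u ∧ (u : EReal) < t_b} t)
    (hβ : ∀ t : ℝ, t ∈ {u : ℝ | t_tilde ≤ u ∧ (u : EReal) < t_b} →
      HasDerivWithinAt β (β' t) {u : ℝ | t_tilde ≤ u ∧ (u : EReal) < t_b} t)
    (hαeq : ∀ t : ℝ, t ∈ {u : ℝ | t_tilde ≤ u ∧ (u : EReal) < t_b} →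
      α' t = (1 / 2) * (β t) ^ 2 - (1 / 2) * (α t) ^ 2 + g t)
    (hβeq : ∀ t : ℝ, t ∈ {u : ℝ | t_tilde ≤ u ∧ (u : EReal) < t_b} →
      β' t = -(α t * β t))
    (hαneg : ∀ t : ℝ, t ∈ {u : ℝ | t_tilde ≤ u ∧ (u : EReal) < t_b} → α t ≤ 0)
    (hαsq : ∀ t : ℝ, t ∈ {u : ℝ | t_tilde ≤ u ∧ (u : EReal) < t_b} → 2 * C ≤ (α t) ^ 2) :
    ∀ t : ℝ, t ∈ {u : ℝ | t_tilde ≤ u ∧ (u : EReal) < t_b} →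
      ∫ s in t_tilde..t, (-α s) ≤ (α t_tilde) ^ 2 / (β t_tilde) ^ 2 := by
  intro t hmem
  have hsub : Set.Icc t_tilde t ⊆ {u : ℝ | t_tilde ≤ u ∧ (u : EReal) < t_b} := fun u hu =>
    ⟨hu.1, (EReal.coe_le_coe_iff.mpr hu.2).trans_lt hmem.2⟩
  have hαcont : ContinuousOn α (Set.Icc t_tilde t) := fun u hu =>
    (hα u (hsub hu)).continuousWithinAt.mono hsub
  have hβcont : ContinuousOn β (Set.Icc t_tilde t) := fun u hu =>
    (hβ u (hsub hu)).continuousWithinAt.mono hsub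
  have hbound := intervalIntegral.integral_le_sub_of_hasDeriv_right_of_le
    (g := fun s => -((α s) ^ 2 / (β s) ^ 2))
    (g' := fun s => -(α s + α s * ((α s) ^ 2 + 2 * g s) / (β s) ^ 2))
    (φ := fun s => -α s) hmem.1
    ((hαcont.pow 2).div (hβcont.pow 2) fun u hu => pow_ne_zero 2 (hβne u (hsub hu))).neg
    (fun u hu => by
      have hu' := hsub (Set.Ioo_subset_Icc_self hu)
      have hβu := hβne u hu'
      have hderiv := (((hα u hu').pow 2).div ((hβ u hu').pow 2) (pow_ne_zero 2 hβu)).neg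
      have hnhds : {u : ℝ | t_tilde ≤ u ∧ (u : EReal) < t_b} ∈ nhdsWithin u (Set.Ioi u) :=
        nhdsWithin_le_nhds (Filter.mem_of_superset (Icc_mem_nhds hu.1 hu.2) hsub)
      refine (hderiv.mono_of_mem_nhdsWithin hnhds).congr_deriv ?_
      simp only [Pi.pow_apply, hαeq u hu', hβeq u hu']
      field_simp
      ring)
    hαcont.neg.integrableOn_Icc
    (fun u hu => by
      have hu' := hsub (Set.Ioo_subset_Icc_self hu)
      have hnonneg : 0 ≤ (α u) ^ 2 + 2 * g u := by
        linarith [(abs_le.mp (hg u hu')).1, hαsq u hu']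
      have hnonpos : α u * ((α u) ^ 2 + 2 * g u) / (β u) ^ 2 ≤ 0 :=
        div_nonpos_of_nonpos_of_nonneg
          (mul_nonpos_of_nonpos_of_nonneg (hαneg u hu') hnonneg) (sq_nonneg _)
      linarith)
  have hpos : 0 ≤ (α t) ^ 2 / (β t) ^ 2 := by positivity
  linarith
end

section
/- Let μ be a finite positive Borel measure on ℝ and define y(ξ) = sup{ x ∈ ℝ : μ((-∞, x)) + x < ξ } for ξ ∈ ℝ. Let x ∈ ℝ with c := μ({x}) > 0, and set ξ₁ = μ((-∞, x)) + x and ξ₂ = μ((-∞, x)) + c + x. Then { ξ ∈ ℝ : y(ξ) = x } is exactly the closed interval [ξ₁, ξ₂], which has length ξ₂ - ξ₁ = c = μ({x}). -/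
open MeasureTheory

open Filter Topology in
theorem exists_lt_of_lt_measureReal_Iio_add (μ : Measure ℝ) [IsFiniteMeasure μ] {x ξ : ℝ}
    (h : ξ < μ.real (Set.Iio x) + x) : ∃ z < x, ξ < μ.real (Set.Iio z) + z := by
  obtain ⟨u, hu, hux, hlim⟩ := exists_seq_strictMono_tendsto x
  have hμ : Tendsto (fun n => μ (Set.Iio (u n))) atTop (𝓝 (μ (Set.Iio x))) := by
    rw [← (isLUB_of_tendsto_atTop hu.monotone hlim).iUnion_Iio_eq]
    exact tendsto_measure_iUnion_atTop fun _ _ hmn => Set.Iio_subset_Iio (hu.monotone hmn)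
  have hF := ((ENNReal.tendsto_toReal (measure_ne_top μ _)).comp hμ).add hlim
  obtain ⟨n, hn⟩ := (hF.eventually_const_lt h).exists
  exact ⟨u n, hux n, hn⟩

open Filter Topology in
theorem exists_gt_of_measureReal_Iic_add_lt (μ : Measure ℝ) [IsFiniteMeasure μ] {x ξ : ℝ}
    (h : μ.real (Set.Iic x) + x < ξ) : ∃ z > x, μ.real (Set.Iio z) + z < ξ := by
  have hμ : Tendsto (μ ∘ Set.Iio) (𝓝[>] x) (𝓝 (μ (Set.Iic x))) := by
    have hInter : ⋂ r > x, Set.Iio r = Set.Iic x := by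
      ext t
      simpa using forall_gt_iff_le
    rw [← hInter]
    exact tendsto_measure_biInter_gt (fun _ _ => measurableSet_Iio.nullMeasurableSet)
      (fun _ _ _ hij => Set.Iio_subset_Iio hij) ⟨x + 1, by simp, measure_ne_top μ _⟩
  have hF := ((ENNReal.tendsto_toReal (measure_ne_top μ _)).comp hμ).add
    (tendsto_nhdsWithin_of_tendsto_nhds (s := Set.Ioi x) (tendsto_id (x := 𝓝 x)))
  obtain ⟨z, hz, hxz⟩ := ((hF.eventually_lt_const h).and self_mem_nhdsWithin).exists
  exact ⟨z, hxz, hz⟩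

theorem measureReal_Iic_eq_Iio_add_singleton (μ : Measure ℝ) [IsFiniteMeasure μ] (x : ℝ) :
    μ.real (Set.Iic x) = μ.real (Set.Iio x) + μ.real {x} := by
  rw [← Set.Iio_union_right, measureReal_union (by simp) (measurableSet_singleton x)]

theorem strictMono_measureReal_Iio_add (μ : Measure ℝ) [IsFiniteMeasure μ] :
    StrictMono fun z : ℝ => μ.real (Set.Iio z) + z := fun _ _ hab =>
  add_lt_add_of_le_of_lt (measureReal_mono (Set.Iio_subset_Iio hab.le)) hab

theorem isLUB_sSup_measureReal_Iio_add_lt (μ : Measure ℝ) [IsFiniteMeasure μ] (ξ : ℝ) :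
    IsLUB {z : ℝ | μ.real (Set.Iio z) + z < ξ} (sSup {z : ℝ | μ.real (Set.Iio z) + z < ξ}) := by
  refine isLUB_csSup ⟨ξ - μ.real Set.univ - 1, ?_⟩ ⟨ξ, fun z hz => ?_⟩
  · have := measureReal_mono (μ := μ) (Set.subset_univ (Set.Iio (ξ - μ.real Set.univ - 1)))
    simp only [Set.mem_ofPred_eq]
    linarith
  · have := measureReal_nonneg (μ := μ) (s := Set.Iio z)
    simp only [Set.mem_ofPred_eq] at hz
    linarith

theorem isLUB_measureReal_Iio_add_lt_iff (μ : Measure ℝ) [IsFiniteMeasure μ] (x ξ : ℝ) :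
    IsLUB {z : ℝ | μ.real (Set.Iio z) + z < ξ} x ↔
      ξ ∈ Set.Icc (μ.real (Set.Iio x) + x) (μ.real (Set.Iic x) + x) := by
  have hmono := strictMono_measureReal_Iio_add μ
  refine ⟨fun h => ⟨?_, ?_⟩, fun ⟨h₁, h₂⟩ => ⟨fun z hz => ?_, fun b hb => ?_⟩⟩
  · by_contra! hlt
    obtain ⟨z, hzx, hz⟩ := exists_lt_of_lt_measureReal_Iio_add μ hlt
    exact hzx.not_ge (h.2 fun w hw => (hmono.lt_iff_lt.1 (lt_trans hw hz)).le)
  · by_contra! hlt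
    obtain ⟨z, hxz, hz⟩ := exists_gt_of_measureReal_Iic_add_lt μ hlt
    exact hxz.not_ge (h.1 hz)
  · by_contra! hxz
    have := measureReal_mono (μ := μ) (Set.Iic_subset_Iio.2 hxz)
    simp only [Set.mem_ofPred_eq] at hz
    linarith
  · exact le_of_forall_lt_imp_le_of_dense fun z hz => hb ((hmono hz).trans_le h₁)

/-- If `μ({x}) = c > 0`, then the set of `ξ` with `y(ξ) = x` (where
`y(ξ) = sup{z : μ((-∞,z)) + z < ξ}`) is exactly the interval
`[μ((-∞,x)) + x, μ((-∞,x)) + c + x]`, of length `c`. -/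
theorem characteristic_map_atom
    (μ : Measure ℝ) [IsFiniteMeasure μ] (y : ℝ → ℝ)
    (hy : ∀ ξ : ℝ, y ξ = sSup {z : ℝ | (μ (Set.Iio z)).toReal + z < ξ})
    (x c ξ₁ ξ₂ : ℝ)
    (hc : c = (μ {x}).toReal) (hcpos : 0 < c)
    (hξ₁ : ξ₁ = (μ (Set.Iio x)).toReal + x)
    (hξ₂ : ξ₂ = (μ (Set.Iio x)).toReal + c + x) :
    {ξ : ℝ | y ξ = x} = Set.Icc ξ₁ ξ₂ ∧ ξ₂ - ξ₁ = c := by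
  subst hξ₁ hξ₂ hc
  refine ⟨Set.ext fun ξ => ?_, by ring⟩
  have hlub := isLUB_sSup_measureReal_Iio_add_lt μ ξ
  have hiff := isLUB_measureReal_Iio_add_lt_iff μ x ξ
  rw [measureReal_Iic_eq_Iio_add_singleton] at hiff
  rw [Set.mem_ofPred_eq, hy]
  exact Iff.trans ⟨fun h => h ▸ hlub, hlub.unique⟩ hiff
end

section
/- Let μ be a finite positive Borel measure on ℝ and define y(ξ) = sup{ x ∈ ℝ : μ((-∞, x)) + x < ξ } for ξ ∈ ℝ. Then y is differentiable almost everywhere, 0 ≤ y'(ξ) ≤ 1 for almost every ξ, the function h := 1 - y' is integrable on ℝ, and ∫_ℝ (1 - y'(ξ)) dξ = μ(ℝ). -/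
open MeasureTheory

/-- The generalized inverse of `x ↦ F x + x`. -/
noncomputable def charMap (F : ℝ → ℝ) (ξ : ℝ) : ℝ := sSup {x : ℝ | F x + x < ξ}

section CharMap

open Set Filter Topology

variable {F : ℝ → ℝ} {M : ℝ}

lemma nonempty_charMap_set (hM : ∀ x, F x ≤ M) (ξ : ℝ) : {x : ℝ | F x + x < ξ}.Nonempty := by
  refine ⟨ξ - M - 1, ?_⟩
  have := hM (ξ - M - 1)
  simp only [mem_ofPred_eq]
  linarith

lemma bddAbove_charMap_set (h0 : ∀ x, 0 ≤ F x) (ξ : ℝ) : BddAbove {x : ℝ | F x + x < ξ} := by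
  refine ⟨ξ, fun x hx => ?_⟩
  have := h0 x
  simp only [mem_ofPred_eq] at hx
  linarith

lemma add_lt_of_lt_charMap (hF : Monotone F) (hM : ∀ x, F x ≤ M) {z ξ : ℝ}
    (h : z < charMap F ξ) : F z + z < ξ := by
  obtain ⟨x, hx, hzx⟩ := exists_lt_of_lt_csSup (nonempty_charMap_set hM ξ) h
  simp only [mem_ofPred_eq] at hx
  linarith [hF hzx.le]

lemma le_add_of_charMap_lt (h0 : ∀ x, 0 ≤ F x) {z ξ : ℝ} (h : charMap F ξ < z) :
    ξ ≤ F z + z := by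
  by_contra! hz
  exact h.not_ge (le_csSup (bddAbove_charMap_set h0 ξ) hz)

lemma charMap_monotone (h0 : ∀ x, 0 ≤ F x) (hM : ∀ x, F x ≤ M) : Monotone (charMap F) :=
  fun _ η h => csSup_le_csSup (bddAbove_charMap_set h0 η) (nonempty_charMap_set hM _)
    fun _ hx => lt_of_lt_of_le hx h

lemma charMap_lipschitzWith (hF : Monotone F) (h0 : ∀ x, 0 ≤ F x) (hM : ∀ x, F x ≤ M) :
    LipschitzWith 1 (charMap F) := by
  refine LipschitzWith.of_le_add fun η ξ => csSup_le (nonempty_charMap_set hM η) fun x hx => ?_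
  have hd : η - ξ ≤ dist η ξ := le_abs_self _
  have hmem : x - dist η ξ ∈ {x : ℝ | F x + x < ξ} := by
    have := hF (sub_le_self x (dist_nonneg (x := η) (y := ξ)))
    simp only [mem_ofPred_eq] at hx ⊢
    linarith
  linarith [le_csSup (bddAbove_charMap_set h0 ξ) hmem, charMap.eq_1 F ξ]

lemma charMap_le (h0 : ∀ x, 0 ≤ F x) (hM : ∀ x, F x ≤ M) (ξ : ℝ) : charMap F ξ ≤ ξ := by
  refine csSup_le (nonempty_charMap_set hM ξ) fun x hx => ?_
  simp only [mem_ofPred_eq] at hx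
  linarith [h0 x]

lemma sub_le_charMap (h0 : ∀ x, 0 ≤ F x) (hM : ∀ x, F x ≤ M) (ξ : ℝ) :
    ξ - M ≤ charMap F ξ := by
  refine le_of_forall_gt fun z hz => ?_
  by_contra! hle
  obtain ⟨w, hw, hwz⟩ := exists_between hz
  linarith [le_add_of_charMap_lt h0 hw, hM w]

lemma sub_charMap_le (hF : Monotone F) (h0 : ∀ x, 0 ≤ F x) (hM : ∀ x, F x ≤ M) (ξ : ℝ) :
    ξ - charMap F ξ ≤ F (ξ + 1) := by
  refine le_of_forall_pos_le_add fun ε hε => ?_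
  have hlt : charMap F ξ < charMap F ξ + min ε 1 := by
    have := lt_min hε one_pos
    linarith
  have h1 : charMap F ξ + min ε 1 ≤ ξ + 1 := by
    linarith [charMap_le h0 hM ξ, min_le_right ε 1]
  linarith [le_add_of_charMap_lt h0 hlt, hF h1, min_le_left ε 1]

lemma le_sub_charMap (hF : Monotone F) (h0 : ∀ x, 0 ≤ F x) (hM : ∀ x, F x ≤ M) (ξ : ℝ) :
    F (ξ - M - 1) ≤ ξ - charMap F ξ := by
  refine le_of_forall_pos_le_add fun ε hε => ?_
  have hlt : charMap F ξ - min ε 1 < charMap F ξ := by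
    have := lt_min hε one_pos
    linarith
  have h1 : ξ - M - 1 ≤ charMap F ξ - min ε 1 := by
    linarith [sub_le_charMap h0 hM ξ, min_le_right ε 1]
  linarith [add_lt_of_lt_charMap hF hM hlt, hF h1, min_le_left ε 1]

lemma tendsto_sub_charMap_atBot (hF : Monotone F) (h0 : ∀ x, 0 ≤ F x) (hM : ∀ x, F x ≤ M)
    (hlim : Tendsto F atBot (𝓝 0)) : Tendsto (fun ξ => ξ - charMap F ξ) atBot (𝓝 0) :=
  squeeze_zero (fun ξ => sub_nonneg.2 (charMap_le h0 hM ξ)) (sub_charMap_le hF h0 hM)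
    (hlim.comp (tendsto_atBot_add_const_right _ 1 tendsto_id))

lemma tendsto_sub_charMap_atTop (hF : Monotone F) (h0 : ∀ x, 0 ≤ F x) (hM : ∀ x, F x ≤ M)
    (hlim : Tendsto F atTop (𝓝 M)) : Tendsto (fun ξ => ξ - charMap F ξ) atTop (𝓝 M) := by
  refine tendsto_of_tendsto_of_tendsto_of_le_of_le (g := fun ξ => F (ξ - M - 1)) ?_
    tendsto_const_nhds (le_sub_charMap hF h0 hM) fun ξ => ?_
  · have : Tendsto (fun ξ : ℝ => ξ + (-M - 1)) atTop atTop :=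
      tendsto_atTop_add_const_right _ _ tendsto_id
    refine hlim.comp (this.congr fun ξ => ?_)
    ring
  · have := sub_le_charMap h0 hM ξ
    dsimp only
    linarith

/-- For a `1`-Lipschitz function `f`, the total integral of `1 - f'` is the difference
of the limits of `x - f x` at `±∞`. -/
lemma LipschitzWith.integrable_one_sub_deriv_and_integral_eq {f : ℝ → ℝ} {m M : ℝ}
    (hf : LipschitzWith 1 f) (hbot : Tendsto (fun x => x - f x) atBot (𝓝 m))
    (htop : Tendsto (fun x => x - f x) atTop (𝓝 M)) :
    Integrable (fun x => 1 - deriv f x) ∧ ∫ x, (1 - deriv f x) = M - m := by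
  have hle (x : ℝ) : 0 ≤ 1 - deriv f x := by
    have := norm_deriv_le_of_lipschitz (x₀ := x) hf
    rw [Real.norm_eq_abs, NNReal.coe_one] at this
    linarith [le_abs_self (deriv f x)]
  have hac (a b : ℝ) : AbsolutelyContinuousOnInterval f a b :=
    hf.lipschitzOnWith.absolutelyContinuousOnInterval
  have hii (a b : ℝ) : IntervalIntegrable (fun x => 1 - deriv f x) volume a b :=
    intervalIntegrable_const.sub (hac a b).intervalIntegrable_deriv
  have hint (a b : ℝ) : ∫ x in a..b, (1 - deriv f x) = (b - f b) - (a - f a) := by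
    rw [intervalIntegral.integral_sub intervalIntegrable_const (hac a b).intervalIntegrable_deriv,
      (hac a b).integral_deriv_eq_sub, intervalIntegral.integral_const, smul_eq_mul]
    ring
  have hlim : Tendsto (fun t : ℝ => ∫ x in (-t)..t, (1 - deriv f x)) atTop (𝓝 (M - m)) := by
    simp only [hint]
    exact htop.sub (hbot.comp tendsto_neg_atTop_atBot)
  have hI : Integrable (fun x => 1 - deriv f x) := by
    refine integrable_of_intervalIntegral_norm_tendsto (a := fun t : ℝ => -t) (b := id) (M - m)
      (fun t => (hii (-t) t).1) tendsto_neg_atTop_atBot tendsto_id ?_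
    simpa only [Real.norm_of_nonneg (hle _), id] using hlim
  exact ⟨hI, tendsto_nhds_unique
    (intervalIntegral_tendsto_integral hI tendsto_neg_atTop_atBot tendsto_id) hlim⟩

end CharMap

section MeasureIio

open Set Filter Topology

variable (μ : Measure ℝ) [IsFiniteMeasure μ]

lemma tendsto_measureReal_Iio_atTop :
    Tendsto (fun x => μ.real (Iio x)) atTop (𝓝 (μ.real univ)) := by
  have h := tendsto_measure_iUnion_atTop (μ := μ) (monotone_Iio (α := ℝ))
  rw [iUnion_Iio] at h
  exact (ENNReal.tendsto_toReal (measure_ne_top μ _)).comp h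

lemma tendsto_measureReal_Iio_atBot :
    Tendsto (fun x => μ.real (Iio x)) atBot (𝓝 0) := by
  have h := tendsto_measure_iInter_atBot (μ := μ) (s := fun x : ℝ => Iio x)
    (fun x => measurableSet_Iio.nullMeasurableSet) monotone_Iio ⟨0, measure_ne_top μ _⟩
  have he : ⋂ x : ℝ, Iio x = ∅ :=
    eq_empty_of_forall_notMem fun x hx => lt_irrefl x (mem_iInter.1 hx x)
  rw [he, measure_empty] at h
  exact (ENNReal.tendsto_toReal ENNReal.zero_ne_top).comp h

end MeasureIio

/-- The characteristic map `y(ξ) = sup{x : μ((-∞,x)) + x < ξ}` is differentiable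
almost everywhere with `0 ≤ y' ≤ 1`, the function `h = 1 - y'` is integrable, and
`∫ (1 - y') = μ(ℝ)`. -/
theorem characteristic_map_derivative
    (μ : Measure ℝ) [IsFiniteMeasure μ] (y : ℝ → ℝ)
    (hy : ∀ ξ : ℝ, y ξ = sSup {x : ℝ | (μ (Set.Iio x)).toReal + x < ξ}) :
    (∀ᵐ ξ ∂(volume : Measure ℝ), DifferentiableAt ℝ y ξ) ∧
    (∀ᵐ ξ ∂(volume : Measure ℝ), 0 ≤ deriv y ξ ∧ deriv y ξ ≤ 1) ∧
    Integrable (fun ξ => 1 - deriv y ξ) volume ∧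
    ∫ ξ, (1 - deriv y ξ) = (μ Set.univ).toReal := by
  have hF : Monotone fun x => μ.real (Set.Iio x) :=
    fun _ _ h => measureReal_mono (Set.Iio_subset_Iio h)
  have h0 (x : ℝ) : 0 ≤ μ.real (Set.Iio x) := measureReal_nonneg
  have hM (x : ℝ) : μ.real (Set.Iio x) ≤ μ.real Set.univ := measureReal_mono (Set.subset_univ _)
  obtain rfl : y = charMap fun x => μ.real (Set.Iio x) := funext hy
  have hlip := charMap_lipschitzWith hF h0 hM
  obtain ⟨hI, hval⟩ := hlip.integrable_one_sub_deriv_and_integral_eq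
    (tendsto_sub_charMap_atBot hF h0 hM (tendsto_measureReal_Iio_atBot μ))
    (tendsto_sub_charMap_atTop hF h0 hM (tendsto_measureReal_Iio_atTop μ))
  refine ⟨hlip.ae_differentiableAt_real, .of_forall fun ξ =>
    ⟨(charMap_monotone h0 hM).deriv_nonneg, ?_⟩, hI, hval.trans (sub_zero _)⟩
  have h := norm_deriv_le_of_lipschitz (x₀ := ξ) hlip
  exact (le_abs_self _).trans (by simpa using h)
end

section
/- Let y : ℝ → ℝ be a nondecreasing, Lipschitz continuous, surjective function, and let ℬ = { ξ ∈ ℝ : y is differentiable at ξ and y'(ξ) > 0 }. Then the complement ℝ \ y(ℬ) of the image of ℬ under y is a Lebesgue null set. -/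
open MeasureTheory

/-- A Lipschitz function on the real line maps Lebesgue null sets to Lebesgue null sets. -/
theorem LipschitzWith.volume_image_eq_zero {f : ℝ → ℝ} {K : NNReal} (hf : LipschitzWith K f)
    {s : Set ℝ} (hs : volume s = 0) : volume (f '' s) = 0 := by
  have h := hf.hausdorffMeasure_image_le zero_le_one s
  rw [hausdorffMeasure_real, hs, mul_zero] at h
  exact nonpos_iff_eq_zero.mp h

/-- The one-dimensional Sard theorem: the set of critical values of a real function is null. -/
theorem volume_image_deriv_eq_zero (f : ℝ → ℝ) :
    volume (f '' {x | DifferentiableAt ℝ f x ∧ deriv f x = 0}) = 0 := by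
  refine addHaar_image_eq_zero_of_det_fderivWithin_eq_zero volume (f' := fun _ ↦ 0) ?_ (by simp)
  rintro x ⟨hx, hx0⟩
  have h := hx.hasDerivAt.hasFDerivAt.hasFDerivWithinAt
    (s := {x | DifferentiableAt ℝ f x ∧ deriv f x = 0})
  simpa [hx0] using h

/-- For a nondecreasing, Lipschitz, surjective `y : ℝ → ℝ`, the complement of the
image under `y` of the set `ℬ = {ξ : y differentiable at ξ and y'(ξ) > 0}` is a
Lebesgue null set. -/
theorem image_of_good_points_has_full_measure
    (y : ℝ → ℝ) (K : NNReal)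
    (hmono : Monotone y) (hlip : LipschitzWith K y)
    (hsurj : Function.Surjective y) :
    volume ((y '' {ξ : ℝ | DifferentiableAt ℝ y ξ ∧ 0 < deriv y ξ})ᶜ) = 0 := by
  refine measure_mono_null ?_ (measure_union_null
    (hlip.volume_image_eq_zero (ae_iff.mp hmono.ae_differentiableAt))
    (volume_image_deriv_eq_zero y))
  intro x hx
  obtain ⟨ξ, rfl⟩ := hsurj x
  by_cases hd : DifferentiableAt ℝ y ξ
  · have hpos : ¬ 0 < deriv y ξ := fun h ↦ hx ⟨ξ, ⟨hd, h⟩, rfl⟩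
    exact Or.inr ⟨ξ, ⟨hd, le_antisymm (not_lt.mp hpos) hmono.deriv_nonneg⟩, rfl⟩
  · exact Or.inl ⟨ξ, hd, rfl⟩
end

section
/- Let κ ≥ 0 and let f : ℝ → ℝ be a bijection such that g := f - id and g̃ := f⁻¹ - id are both bounded and Lipschitz continuous, with (sup|g| + Lip(g)) + (sup|g̃| + Lip(g̃)) ≤ κ, where Lip denotes the least Lipschitz constant. Then at every point ξ at which f is differentiable (which is almost every ξ ∈ ℝ, by Rademacher's theorem), one has 1/(1+κ) ≤ f'(ξ) ≤ 1 + κ. -/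
open Filter Topology in
/-- Bounds on the forward difference quotients of a function pass to its derivative. -/
theorem HasDerivAt.mem_Icc_of_increment_bounds {f : ℝ → ℝ} {a b d ξ : ℝ} (hd : HasDerivAt f d ξ)
    (h : ∀ y, ξ < y → a * (y - ξ) ≤ f y - f ξ ∧ f y - f ξ ≤ b * (y - ξ)) :
    a ≤ d ∧ d ≤ b := by
  have ht : Tendsto (slope f ξ) (𝓝[>] ξ) (𝓝 d) :=
    (hasDerivAt_iff_tendsto_slope.mp hd).mono_left
      (nhdsWithin_mono _ fun y (hy : ξ < y) => hy.ne')
  constructor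
  · refine ge_of_tendsto ht ?_
    filter_upwards [self_mem_nhdsWithin] with y (hy : ξ < y)
    rw [slope_def_field, le_div_iff₀ (sub_pos.mpr hy)]
    exact (h y hy).1
  · refine le_of_tendsto ht ?_
    filter_upwards [self_mem_nhdsWithin] with y (hy : ξ < y)
    rw [slope_def_field, div_le_iff₀ (sub_pos.mpr hy)]
    exact (h y hy).2

/-- A continuous injective real function at bounded distance from the identity is
strictly increasing. -/
theorem Continuous.strictMono_of_abs_sub_id_le {f : ℝ → ℝ} {M : ℝ} (hf : Continuous f)
    (hinj : Function.Injective f) (hM : ∀ x, |f x - x| ≤ M) : StrictMono f := by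
  refine (hf.strictMono_of_inj hinj).resolve_right fun hanti => ?_
  have h0 := abs_le.mp (hM 0)
  have h1 := abs_le.mp (hM (2 * M + 1))
  have hlt : f (2 * M + 1) < f 0 := hanti (by linarith)
  linarith

/-- A Lipschitz perturbation of the identity has bounded forward increments. -/
theorem LipschitzWith.sub_le_one_add_mul_of_sub_id {f : ℝ → ℝ} {L : NNReal}
    (hL : LipschitzWith L (fun x => f x - x)) {x y : ℝ} (hxy : x ≤ y) :
    f y - f x ≤ (1 + L) * (y - x) := by
  have h := hL.dist_le_mul y x
  rw [Real.dist_eq, Real.dist_eq, abs_of_nonneg (sub_nonneg.mpr hxy)] at h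
  linarith [(abs_le.mp h).2]

/-- Lemma 2.4 of the paper (first direction): if `f : ℝ → ℝ` is a bijection such that
`f - id` and `f⁻¹ - id` are bounded and Lipschitz, with the sum of their sup norms and
(least) Lipschitz constants at most `κ`, then at every point of differentiability of `f`
one has `1/(1+κ) ≤ f' ≤ 1+κ`. -/
theorem relabeling_derivative_bounds
    (κ : ℝ) (hκ : 0 ≤ κ) (f finv : ℝ → ℝ)
    (hli : Function.LeftInverse finv f) (hri : Function.RightInverse finv f)
    (M₁ M₂ : ℝ) (L₁ L₂ : NNReal)
    (hM₁ : ∀ x, |f x - x| ≤ M₁)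
    (hL₁ : LipschitzWith L₁ (fun x => f x - x))
    (hM₂ : ∀ x, |finv x - x| ≤ M₂)
    (hL₂ : LipschitzWith L₂ (fun x => finv x - x))
    (hsum : (M₁ + L₁) + (M₂ + L₂) ≤ κ) :
    ∀ (ξ d : ℝ), HasDerivAt f d ξ → 1 / (1 + κ) ≤ d ∧ d ≤ 1 + κ := by
  intro ξ d hd
  have hcont : Continuous f := by
    have h : Continuous fun x => (f x - x) + x := hL₁.continuous.add continuous_id
    simpa using h
  have hmono := hcont.strictMono_of_abs_sub_id_le hli.injective hM₁
  have hM₁0 : 0 ≤ M₁ := (abs_nonneg _).trans (hM₁ 0)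
  have hM₂0 : 0 ≤ M₂ := (abs_nonneg _).trans (hM₂ 0)
  have hL₁κ : (L₁ : ℝ) ≤ κ := by linarith [L₂.coe_nonneg]
  have hL₂κ : (L₂ : ℝ) ≤ κ := by linarith [L₁.coe_nonneg]
  refine hd.mem_Icc_of_increment_bounds fun y hy => ⟨?_, ?_⟩
  · have hfy : f ξ < f y := hmono hy
    have h := hL₂.sub_le_one_add_mul_of_sub_id hfy.le
    rw [hli, hli] at h
    rw [one_div, inv_mul_le_iff₀ (by linarith)]
    exact h.trans (mul_le_mul_of_nonneg_right (by linarith) (by linarith))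
  · exact (hL₁.sub_le_one_add_mul_of_sub_id hy.le).trans
      (mul_le_mul_of_nonneg_right (by linarith) (by linarith))
end

section
/- Let d ≥ 1 and let f : ℝ → ℝ be locally absolutely continuous such that f - id is bounded and 1/d ≤ f'(ξ) ≤ d for almost every ξ ∈ ℝ. Then f is a homeomorphism of ℝ onto ℝ; moreover sup|f⁻¹ - id| = sup|f - id|, the inverse f⁻¹ is Lipschitz continuous with constant d, and f⁻¹ - id is Lipschitz continuous with constant d - 1. -/
open MeasureTheory

theorem integral_mem_Icc_of_ae_mem_Icc {g : ℝ → ℝ} {m M a b : ℝ} (hab : a ≤ b)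
    (hg : LocallyIntegrable g volume) (hbd : ∀ᵐ x ∂(volume : Measure ℝ), m ≤ g x ∧ g x ≤ M) :
    m * (b - a) ≤ ∫ x in a..b, g x ∧ ∫ x in a..b, g x ≤ M * (b - a) := by
  have hgi : IntervalIntegrable g volume a b :=
    (hg.integrableOn_isCompact isCompact_uIcc).intervalIntegrable
  have hlo := intervalIntegral.integral_mono_ae hab (intervalIntegrable_const (c := m)) hgi
    (hbd.mono fun x hx => hx.1)
  have hhi := intervalIntegral.integral_mono_ae hab hgi (intervalIntegrable_const (c := M))
    (hbd.mono fun x hx => hx.2)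
  simp only [intervalIntegral.integral_const, smul_eq_mul] at hlo hhi
  constructor <;> linarith

theorem lipschitzWith_of_forall_le_abs_sub_le {g : ℝ → ℝ} {K : NNReal}
    (h : ∀ x y, x ≤ y → |g y - g x| ≤ K * (y - x)) : LipschitzWith K g := by
  refine LipschitzWith.of_dist_le_mul fun x y => ?_
  rcases le_total x y with hxy | hxy
  · rw [dist_comm (g x), dist_comm x, Real.dist_eq, Real.dist_eq, abs_of_nonneg (sub_nonneg.2 hxy)]
    exact h x y hxy
  · rw [Real.dist_eq, Real.dist_eq, abs_of_nonneg (sub_nonneg.2 hxy)]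
    exact h y x hxy

theorem surjective_of_continuous_of_abs_sub_le {f : ℝ → ℝ} {M : ℝ} (hf : Continuous f)
    (hbd : ∀ x, |f x - x| ≤ M) : Function.Surjective f := by
  refine hf.surjective ?_ ?_
  · refine Filter.tendsto_atTop_mono (fun x => ?_)
      (Filter.tendsto_atTop_add_const_right _ (-M) Filter.tendsto_id)
    have := (abs_le.1 (hbd x)).1
    simp only [id]
    linarith
  · refine Filter.tendsto_atBot_mono (fun x => ?_)
      (Filter.tendsto_atBot_add_const_right _ M Filter.tendsto_id)
    have := (abs_le.1 (hbd x)).2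
    simp only [id]
    linarith

/-- Lemma 2.4 of the paper (converse direction): if `f : ℝ → ℝ` is locally absolutely
continuous (expressed here via the fundamental theorem of calculus with a locally
integrable a.e. derivative `f'`), `f - id` is bounded, and `1/d ≤ f' ≤ d` almost
everywhere for some `d ≥ 1`, then `f` is a homeomorphism of `ℝ` onto `ℝ`, with
`sup|f⁻¹ - id| = sup|f - id|`, `f⁻¹` Lipschitz with constant `d`, and `f⁻¹ - id`
Lipschitz with constant `d - 1`. -/
theorem relabeling_converse
    (d : NNReal) (hd : 1 ≤ d) (f f' : ℝ → ℝ) (M : ℝ)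
    (hbd : ∀ x, |f x - x| ≤ M)
    (hint : LocallyIntegrable f' volume)
    (hf' : ∀ᵐ x ∂(volume : Measure ℝ), 1 / (d : ℝ) ≤ f' x ∧ f' x ≤ d)
    (hftc : ∀ a b : ℝ, f b - f a = ∫ x in a..b, f' x) :
    ∃ F : ℝ ≃ₜ ℝ, (∀ x, F x = f x) ∧
      sSup (Set.range fun x => |F.symm x - x|) = sSup (Set.range fun x => |f x - x|) ∧
      LipschitzWith d F.symm ∧
      LipschitzWith (d - 1) (fun x => F.symm x - x) := by
  have hd1 : (1 : ℝ) ≤ d := by exact_mod_cast hd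
  have hd0 : (0 : ℝ) < d := by linarith
  have hlo : ∀ x y, x ≤ y → y - x ≤ d * (f y - f x) := fun x y hxy => by
    have h := (integral_mem_Icc_of_ae_mem_Icc hxy hint hf').1
    rwa [← hftc, one_div, inv_mul_le_iff₀ hd0] at h
  have hhi : ∀ x y, x ≤ y → f y - f x ≤ d * (y - x) := fun x y hxy => by
    rw [hftc]
    exact (integral_mem_Icc_of_ae_mem_Icc hxy hint hf').2
  have hmono : StrictMono f := fun x y hxy => by
    have := hlo x y hxy.le
    exact sub_pos.1 (pos_of_mul_pos_right (by linarith) hd0.le)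
  have hlip : LipschitzWith d f := lipschitzWith_of_forall_le_abs_sub_le fun x y hxy => by
    rw [abs_of_nonneg (sub_nonneg.2 (hmono.monotone hxy))]
    exact hhi x y hxy
  let e := hmono.orderIsoOfSurjective f
    (surjective_of_continuous_of_abs_sub_le hlip.continuous hbd)
  have hfe : ∀ y, f (e.symm y) = y := e.apply_symm_apply
  have hlo' : ∀ x y, x ≤ y → e.symm y - e.symm x ≤ d * (y - x) := fun x y hxy => by
    simpa only [hfe] using hlo _ _ (e.symm.monotone hxy)
  have hhi' : ∀ x y, x ≤ y → y - x ≤ d * (e.symm y - e.symm x) := fun x y hxy => by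
    simpa only [hfe] using hhi _ _ (e.symm.monotone hxy)
  refine ⟨e.toHomeomorph, fun x => rfl, ?_, ?_, ?_⟩
  · congr 1
    change Set.range (fun x => |e.symm x - x|) = _
    rw [← e.surjective.range_comp]
    congr 1
    funext x
    simp only [Function.comp_apply, e.symm_apply_apply]
    exact abs_sub_comm _ _
  · refine lipschitzWith_of_forall_le_abs_sub_le fun x y hxy => ?_
    change |e.symm y - e.symm x| ≤ _
    rw [abs_of_nonneg (sub_nonneg.2 (e.symm.monotone hxy))]
    exact hlo' x y hxy
  · refine lipschitzWith_of_forall_le_abs_sub_le fun x y hxy => ?_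
    change |e.symm y - y - (e.symm x - x)| ≤ _
    rw [NNReal.coe_sub hd, NNReal.coe_one, abs_le]
    have h1 := hlo' x y hxy
    have h2 := hhi' x y hxy
    have h3 : e.symm x ≤ e.symm y := e.symm.monotone hxy
    constructor
    · by_contra! h
      nlinarith [mul_nonneg (sub_nonneg.2 hd1) (sub_nonneg.2 hd1),
        mul_nonneg (mul_nonneg (sub_nonneg.2 hd1) (sub_nonneg.2 hd1)) (sub_nonneg.2 hxy)]
    · linarith
end

section
/- Let y : ℝ → ℝ be nondecreasing and Lipschitz continuous, let h : ℝ → [0, ∞) be locally integrable, and let r : ℝ → ℝ be measurable with r(ξ)² ≤ y'(ξ)·h(ξ) for almost every ξ ∈ ℝ (y' denoting the a.e. derivative of y). Then for every Borel set B ⊆ ℝ of Lebesgue measure zero, r(ξ) = 0 for almost every ξ ∈ y⁻¹(B). Consequently, the push-forward under y of the measure r(ξ) dξ is absolutely continuous with respect to Lebesgue measure. -/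
open MeasureTheory

/-- The derivative of a monotone function vanishes almost everywhere on the preimage of a null
set. -/
theorem Monotone.ae_deriv_eq_zero_of_mem_null {f : ℝ → ℝ} (hf : Monotone f) {B : Set ℝ}
    (hB : MeasurableSet B) (hB0 : volume B = 0) :
    ∀ᵐ x ∂(volume : Measure ℝ), f x ∈ B → deriv f x = 0 := by
  have hs : MeasurableSet ({x | DifferentiableAt ℝ f x} ∩ f ⁻¹' B) :=
    (measurableSet_of_differentiableAt ℝ f).inter (hf.measurable hB)
  have hint : ∫⁻ x in {x | DifferentiableAt ℝ f x} ∩ f ⁻¹' B, ENNReal.ofReal (deriv f x) = 0 := by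
    rw [lintegral_deriv_eq_volume_image_of_monotoneOn hs
      (fun x hx => hx.1.hasDerivAt.hasDerivWithinAt) (hf.monotoneOn _)]
    exact measure_mono_null (Set.image_subset_iff.2 Set.inter_subset_right) hB0
  rw [lintegral_eq_zero_iff (measurable_deriv f).ennreal_ofReal, Filter.EventuallyEq,
    ae_restrict_iff' hs] at hint
  filter_upwards [hint, hf.ae_differentiableAt] with x hx hdiff hxB
  exact le_antisymm (ENNReal.ofReal_eq_zero.1 (hx ⟨hdiff, hxB⟩)) hf.deriv_nonneg

/-- Absolute continuity of `y_#(r dξ)` (Theorem 2.7 of the paper): if `y` is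
nondecreasing and Lipschitz, `h ≥ 0` is locally integrable, and `r² ≤ y'·h` a.e.,
then `r = 0` a.e. on the preimage of any Lebesgue-null Borel set, and consequently
the push-forward under `y` of the measure `r(ξ) dξ` is absolutely continuous with
respect to Lebesgue measure. -/
theorem pushforward_absolutely_continuous
    (y h r : ℝ → ℝ) (K : NNReal)
    (hmono : Monotone y) (hlip : LipschitzWith K y)
    (hh : ∀ ξ, 0 ≤ h ξ) (hhint : LocallyIntegrable h volume)
    (hr : Measurable r)
    (hconstraint : ∀ᵐ ξ ∂(volume : Measure ℝ), (r ξ) ^ 2 ≤ deriv y ξ * h ξ) :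
    (∀ B : Set ℝ, MeasurableSet B → volume B = 0 →
      ∀ᵐ ξ ∂(volume : Measure ℝ), y ξ ∈ B → r ξ = 0) ∧
    (volume.withDensity fun ξ => ENNReal.ofReal |r ξ|).map y ≪ volume := by
  have hzero : ∀ B : Set ℝ, MeasurableSet B → volume B = 0 →
      ∀ᵐ ξ ∂(volume : Measure ℝ), y ξ ∈ B → r ξ = 0 := by
    intro B hB hB0
    filter_upwards [hconstraint, hmono.ae_deriv_eq_zero_of_mem_null hB hB0] with ξ hξ hderiv hξB
    rw [hderiv hξB, zero_mul] at hξ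
    exact pow_eq_zero_iff two_ne_zero |>.1 (le_antisymm hξ (sq_nonneg _))
  refine ⟨hzero, Measure.AbsolutelyContinuous.mk fun B hB hB0 => ?_⟩
  have hpre : MeasurableSet (y ⁻¹' B) := hmono.measurable hB
  rw [Measure.map_apply hmono.measurable hB, withDensity_apply _ hpre]
  refine setLIntegral_eq_zero_iff hpre (by fun_prop) |>.2 ?_
  filter_upwards [hzero B hB hB0] with ξ hξ hξB
  simp [hξ hξB]
end
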